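/- arXiv:2603.10327 — 8 statements merged into one kernel-verified Lean document; each statement's English description precedes it below -/
import Mathlib

section
/- Let n ≥ 1 and let f : ℝ^n → ℝ. Then f satisfies (B1) positive homogeneity and translation invariance, (B2) monotonicity, (B3) comonotonic sub-additivity, and (B4) permutation invariance if and only if there exists a closed convex set W ⊆ D (the probability simplex) such that f(x) = sup_{μ ∈ W} ⟨μ, x^q⟩ for every x ∈ ℝ^n, where x^q is the vector obtained by rearranging the coordinates of x in non-decreasing order and ⟨·,·⟩ is the standard inner product. -/
open Finset

theorem sort_comp_eq_of_monotone {n : ℕ} {x : Fin n → ℝ} {σ : Equiv.Perm (Fin n)}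
    (h : Monotone (x ∘ σ)) : x ∘ Tuple.sort x = x ∘ σ :=
  (Tuple.comp_sort_eq_comp_iff_monotone.mpr h).symm

theorem sort_comp_le_sort_comp {n : ℕ} {x y : Fin n → ℝ} (h : ∀ i, x i ≤ y i) (i : Fin n) :
    (x ∘ Tuple.sort x) i ≤ (y ∘ Tuple.sort y) i := by
  by_contra! hlt
  have hmaps : ∀ j ∈ Iic i, (Tuple.sort x).symm (Tuple.sort y j) ∈ Iio i := by
    intro j hj
    rw [mem_Iic] at hj
    rw [mem_Iio]
    by_contra! hk
    have h1 := Tuple.monotone_sort x hk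
    have h2 := Tuple.monotone_sort y hj
    have h3 := h (Tuple.sort y j)
    simp only [Function.comp_apply, Equiv.apply_symm_apply] at h1 h2 hlt
    linarith
  have hcard := card_le_card_of_injOn _ hmaps
    ((Tuple.sort x).symm.injective.comp (Tuple.sort y).injective).injOn
  simp at hcard

theorem sort_comp_add_of_comonotone {n : ℕ} {x y : Fin n → ℝ}
    (h : ∀ i j, 0 ≤ (x i - x j) * (y i - y j)) :
    (x + y) ∘ Tuple.sort (x + y) = x ∘ Tuple.sort x + y ∘ Tuple.sort y := by
  have hs := Tuple.monotone_sort (x + y)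
  have hx : Monotone (x ∘ Tuple.sort (x + y)) := by
    intro i j hij
    have h1 := hs hij
    have h2 := h (Tuple.sort (x + y) i) (Tuple.sort (x + y) j)
    simp only [Function.comp_apply, Pi.add_apply] at h1 ⊢
    by_contra! hlt
    nlinarith
  have hy : Monotone (y ∘ Tuple.sort (x + y)) := by
    intro i j hij
    have h1 := hs hij
    have h2 := h (Tuple.sort (x + y) i) (Tuple.sort (x + y) j)
    simp only [Function.comp_apply, Pi.add_apply] at h1 ⊢
    by_contra! hlt
    nlinarith
  rw [sort_comp_eq_of_monotone hx, sort_comp_eq_of_monotone hy]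
  rfl

/-- The least monotone majorant of a tuple. -/
noncomputable def runningMax {n : ℕ} (x : Fin n → ℝ) (i : Fin n) : ℝ :=
  (Iic i).sup' nonempty_Iic x

theorem runningMax_monotone {n : ℕ} (x : Fin n → ℝ) : Monotone (runningMax x) :=
  fun _ _ hij => sup'_mono x (Iic_subset_Iic.mpr hij) nonempty_Iic

theorem le_runningMax {n : ℕ} (x : Fin n → ℝ) {i j : Fin n} (h : j ≤ i) :
    x j ≤ runningMax x i :=
  le_sup' x (mem_Iic.mpr h)

theorem runningMax_le {n : ℕ} {x : Fin n → ℝ} {i : Fin n} {c : ℝ} (h : ∀ j ≤ i, x j ≤ c) :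
    runningMax x i ≤ c :=
  sup'_le _ _ fun j hj => h j (mem_Iic.mp hj)

theorem runningMax_eq_of_monotone {n : ℕ} {x : Fin n → ℝ} (h : Monotone x) :
    runningMax x = x :=
  funext fun _ => le_antisymm (runningMax_le fun _ hj => h hj) (le_runningMax x le_rfl)

theorem runningMax_smul {n : ℕ} {c : ℝ} (hc : 0 < c) (x : Fin n → ℝ) :
    runningMax (c • x) = c • runningMax x := by
  funext i
  refine le_antisymm (runningMax_le fun j hj => ?_) ?_
  · exact mul_le_mul_of_nonneg_left (le_runningMax x hj) hc.le
  · have : runningMax x i ≤ runningMax (c • x) i / c :=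
      runningMax_le fun j hj => by
        rw [le_div_iff₀ hc, mul_comm]
        exact le_runningMax (c • x) hj
    rw [le_div_iff₀ hc, mul_comm] at this
    exact this

theorem comonotone_of_monotone {n : ℕ} {x y : Fin n → ℝ} (hx : Monotone x) (hy : Monotone y)
    (i j : Fin n) : 0 ≤ (x i - x j) * (y i - y j) := by
  rcases le_total i j with h | h
  · exact mul_nonneg_of_nonpos_of_nonpos (sub_nonpos.mpr (hx h)) (sub_nonpos.mpr (hy h))
  · exact mul_nonneg (sub_nonneg.mpr (hx h)) (sub_nonneg.mpr (hy h))

/-- A sublinear functional admits a dominated linear functional touching it at a given point. -/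
theorem exists_linear_le_sublinear_eq_at {E : Type*} [AddCommGroup E] [Module ℝ E] (N : E → ℝ)
    (hhom : ∀ c : ℝ, 0 < c → ∀ x, N (c • x) = c * N x) (hadd : ∀ x y, N (x + y) ≤ N x + N y)
    (x₀ : E) : ∃ g : E →ₗ[ℝ] ℝ, g x₀ = N x₀ ∧ ∀ x, g x ≤ N x := by
  have h0 : N 0 = 0 := by
    have := hhom 2 two_pos 0
    rw [smul_zero] at this
    linarith
  have H : ∀ c : ℝ, c • x₀ = 0 → c • N x₀ = 0 := by
    intro c hc
    rcases smul_eq_zero.mp hc with h | h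
    · simp [h]
    · simp [h, h0]
  obtain ⟨g, hg, hle⟩ := exists_extension_of_le_sublinear
    (LinearPMap.mkSpanSingleton' x₀ (N x₀) H) N hhom hadd (by
      rintro ⟨x, hx⟩
      obtain ⟨c, rfl⟩ := Submodule.mem_span_singleton.mp hx
      rw [LinearPMap.mkSpanSingleton'_apply]
      change c * N x₀ ≤ N (c • x₀)
      rcases lt_trichotomy c 0 with hc | rfl | hc
      · have h1 := hadd (c • x₀) ((-c) • x₀)
        rw [hhom (-c) (neg_pos.mpr hc), ← add_smul, add_neg_cancel, zero_smul, h0] at h1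
        linarith
      · simp [h0]
      · exact (hhom c hc x₀).ge)
  refine ⟨g, ?_, hle⟩
  have hx₀ : x₀ ∈ Submodule.span ℝ {x₀} := Submodule.mem_span_singleton_self x₀
  exact (hg ⟨x₀, hx₀⟩).trans (LinearPMap.mkSpanSingleton'_apply_self x₀ (N x₀) H hx₀)

/-- Supporting weights at a monotone point for a monotone, translation invariant functional that is
sublinear on the cone of monotone tuples. -/
theorem exists_weights_eq_at {n : ℕ} {f : (Fin n → ℝ) → ℝ}
    (hhom : ∀ (x : Fin n → ℝ) (a b : ℝ), 0 ≤ a → f (fun i => a * x i + b) = a * f x + b)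
    (hmono : ∀ x y : Fin n → ℝ, (∀ i, x i ≤ y i) → f x ≤ f y)
    (hadd : ∀ x y : Fin n → ℝ, (∀ i j, 0 ≤ (x i - x j) * (y i - y j)) →
      f (x + y) ≤ f x + f y) {x₀ : Fin n → ℝ} (hx₀ : Monotone x₀) :
    ∃ μ : Fin n → ℝ, (∑ i, μ i = 1) ∧ (∀ i, 0 ≤ μ i) ∧
      (∀ x, Monotone x → ∑ i, μ i * x i ≤ f x) ∧ ∑ i, μ i * x₀ i = f x₀ := by
  have hconst (b : ℝ) : f (fun _ => b) = b := by simpa using hhom 0 0 b le_rfl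
  have hsmul (c : ℝ) (hc : 0 ≤ c) (x : Fin n → ℝ) : f (c • x) = c * f x := by
    have := hhom x c 0 hc
    simp only [add_zero] at this
    exact this
  obtain ⟨g, hg, hle⟩ := exists_linear_le_sublinear_eq_at (fun x => f (runningMax x))
    (fun c hc x => by rw [runningMax_smul hc, hsmul c hc.le])
    (fun x y => (hmono _ _ fun i => runningMax_le fun j hj =>
        add_le_add (le_runningMax x hj) (le_runningMax y hj)).trans
      (hadd _ _ (comonotone_of_monotone (runningMax_monotone x) (runningMax_monotone y)))) x₀
  have hsum (x : Fin n → ℝ) : ∑ i, g (Pi.single i 1) * x i = g x := by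
    rw [LinearMap.pi_apply_eq_sum_univ g x]
    refine sum_congr rfl fun i _ => ?_
    rw [smul_eq_mul, mul_comm]
    congr 2
    ext j
    simp [Pi.single_apply, eq_comm]
  have hle_of_monotone (x : Fin n → ℝ) (hx : Monotone x) : g x ≤ f x := by
    simpa only [runningMax_eq_of_monotone hx] using hle x
  refine ⟨fun i => g (Pi.single i 1), ?_, fun i => ?_, fun x hx => ?_, ?_⟩
  · have h1 := hle_of_monotone (fun _ => 1) monotone_const
    have h2 := hle_of_monotone (-fun _ => 1) monotone_const
    rw [map_neg] at h2
    have h3 : f (-fun _ => 1) = -1 := hconst (-1)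
    rw [hconst] at h1
    have h4 := hsum fun _ => 1
    simp only [mul_one] at h4
    linarith
  · have h1 := hle (-Pi.single i 1)
    have h2 : f (runningMax (-Pi.single i 1)) ≤ f fun _ => 0 := by
      refine hmono _ _ fun k => runningMax_le fun j _ => ?_
      by_cases h : j = i <;> simp [h]
    rw [hconst] at h2
    rw [map_neg] at h1
    linarith
  · rw [hsum]
    exact hle_of_monotone x hx
  · rw [hsum, hg]
    exact congrArg f (runningMax_eq_of_monotone hx₀)

theorem bddAbove_image_weighted_sum {n : ℕ} {W : Set (Fin n → ℝ)}
    (hW : ∀ μ ∈ W, (∑ i, μ i = 1) ∧ ∀ i, 0 ≤ μ i) (z : Fin n → ℝ) :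
    BddAbove ((fun μ : Fin n → ℝ => ∑ i, μ i * z i) '' W) := by
  refine ⟨∑ i, |z i|, ?_⟩
  rintro _ ⟨μ, hμ, rfl⟩
  obtain ⟨h1, h0⟩ := hW μ hμ
  refine sum_le_sum fun i _ => ?_
  have : μ i ≤ 1 := h1 ▸ single_le_sum (fun j _ => h0 j) (mem_univ i)
  nlinarith [le_abs_self (z i), abs_nonneg (z i), h0 i]

/-- A function `f : ℝⁿ → ℝ` satisfies (B1) positive homogeneity and
translation invariance, (B2) monotonicity, (B3) comonotonic sub-additivity and
(B4) permutation invariance iff it is a supremum of weighted averages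
`⟨μ, x^q⟩` over a nonempty closed convex subset `W` of the probability simplex,
where `x^q` is `x` sorted in non-decreasing order. -/
theorem stmt0 (n : ℕ) (hn : 1 ≤ n) (f : (Fin n → ℝ) → ℝ) :
    ((∀ (x : Fin n → ℝ) (a b : ℝ), 0 ≤ a → f (fun i => a * x i + b) = a * f x + b) ∧
      (∀ x y : Fin n → ℝ, (∀ i, x i ≤ y i) → f x ≤ f y) ∧
      (∀ x y : Fin n → ℝ, (∀ i j, 0 ≤ (x i - x j) * (y i - y j)) →
        f (x + y) ≤ f x + f y) ∧
      (∀ (x : Fin n → ℝ) (π : Equiv.Perm (Fin n)), f (x ∘ π) = f x)) ↔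
    (∃ W : Set (Fin n → ℝ), W.Nonempty ∧ IsClosed W ∧ Convex ℝ W ∧
      (∀ μ ∈ W, (∑ i, μ i = 1) ∧ ∀ i, 0 ≤ μ i) ∧
      ∀ x : Fin n → ℝ,
        f x = sSup ((fun μ : Fin n → ℝ => ∑ i, μ i * (x ∘ Tuple.sort x) i) '' W)) := by
  constructor
  · rintro ⟨hhom, hmono, hadd, hperm⟩
    refine ⟨stdSimplex ℝ (Fin n) ∩ ⋂ (x : Fin n → ℝ) (_ : Monotone x),
      {μ | ∑ i, μ i * x i ≤ f x}, ?_, ?_, ?_, fun μ hμ => ⟨hμ.1.2, hμ.1.1⟩, fun x => ?_⟩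
    · obtain ⟨μ, h1, h0, hle, -⟩ := exists_weights_eq_at hhom hmono hadd
        (monotone_const (c := (0 : ℝ)))
      exact ⟨μ, ⟨h0, h1⟩, Set.mem_iInter₂.mpr hle⟩
    · refine (isClosed_stdSimplex (𝕜 := ℝ) (ι := Fin n)).inter (isClosed_biInter fun x _ => ?_)
      exact isClosed_le (by fun_prop) continuous_const
    · refine (convex_stdSimplex ℝ (Fin n)).inter (convex_iInter₂ fun x _ => ?_)
      refine convex_halfSpace_le ⟨fun μ ν => ?_, fun c μ => ?_⟩ (f x)
      · simp [add_mul, sum_add_distrib]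
      · simp [mul_sum, mul_assoc]
    · obtain ⟨μ, h1, h0, hle, heq⟩ := exists_weights_eq_at hhom hmono hadd (Tuple.monotone_sort x)
      rw [← hperm x (Tuple.sort x)]
      refine Eq.symm (IsGreatest.csSup_eq ?_)
      refine ⟨⟨μ, ⟨⟨h0, h1⟩, Set.mem_iInter₂.mpr hle⟩, heq⟩, ?_⟩
      rintro _ ⟨ν, hν, rfl⟩
      exact Set.mem_iInter₂.mp hν.2 _ (Tuple.monotone_sort x)
  · rintro ⟨W, hne, -, -, hW, hf⟩
    have hle (x : Fin n → ℝ) {μ : Fin n → ℝ} (hμ : μ ∈ W) :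
        ∑ i, μ i * (x ∘ Tuple.sort x) i ≤ f x :=
      hf x ▸ le_csSup (bddAbove_image_weighted_sum hW _) ⟨μ, hμ, rfl⟩
    have hub {x : Fin n → ℝ} {c : ℝ} (h : ∀ μ ∈ W, ∑ i, μ i * (x ∘ Tuple.sort x) i ≤ c) :
        f x ≤ c := by
      rw [hf x]
      refine csSup_le (hne.image _) ?_
      rintro _ ⟨μ, hμ, rfl⟩
      exact h μ hμ
    refine ⟨fun x a b ha => ?_, fun x y hxy => ?_, fun x y hxy => ?_, fun x π => ?_⟩
    · have hsort : (fun i => a * x i + b) ∘ Tuple.sort (fun i => a * x i + b) =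
          fun i => a * (x ∘ Tuple.sort x) i + b :=
        sort_comp_eq_of_monotone (σ := Tuple.sort x) fun i j hij =>
          add_le_add_left (mul_le_mul_of_nonneg_left (Tuple.monotone_sort x hij) ha) b
      have hsum : ∀ μ ∈ W, ∑ i, μ i * ((fun i => a * x i + b) ∘
          Tuple.sort (fun i => a * x i + b)) i = a * ∑ i, μ i * (x ∘ Tuple.sort x) i + b := by
        intro μ hμ
        simp only [hsort, mul_add, sum_add_distrib, ← sum_mul, (hW μ hμ).1, one_mul, mul_sum,
          mul_left_comm]
      refine le_antisymm (hub fun μ hμ => ?_) ?_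
      · rw [hsum μ hμ]
        exact add_le_add_left (mul_le_mul_of_nonneg_left (hle x hμ) ha) b
      · rcases ha.eq_or_lt with rfl | ha
        · obtain ⟨μ, hμ⟩ := hne
          have := hle (fun i => 0 * x i + b) hμ
          rw [hsum μ hμ] at this
          simpa only [zero_mul] using this
        · have : f x ≤ (f (fun i => a * x i + b) - b) / a := hub fun μ hμ => by
            have := hle (fun i => a * x i + b) hμ
            rw [hsum μ hμ] at this
            rw [le_div_iff₀ ha]
            linarith
          rw [le_div_iff₀ ha] at this
          linarith
    · exact hub fun μ hμ => (sum_le_sum fun i _ => mul_le_mul_of_nonneg_left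
        (sort_comp_le_sort_comp hxy i) ((hW μ hμ).2 i)).trans (hle y hμ)
    · refine hub fun μ hμ => ?_
      simp only [sort_comp_add_of_comonotone hxy, Pi.add_apply, mul_add, sum_add_distrib]
      exact add_le_add (hle x hμ) (hle y hμ)
    · rw [hf, hf, Tuple.comp_perm_comp_sort_eq_comp_sort]
end

section
/- Let n ≥ 1 and let f : ℝ^n → ℝ. Then f satisfies (B1) positive homogeneity and translation invariance, (B2) monotonicity, (B3') full sub-additivity (f(x+y) ≤ f(x) + f(y) for all x, y ∈ ℝ^n), and (B4) permutation invariance if and only if there exists a closed convex set W ⊆ D ∩ C, where C = {x ∈ ℝ^n : x_1 ≤ x_2 ≤ … ≤ x_n}, such that f(x) = sup_{μ ∈ W} ⟨μ, x^q⟩ for every x ∈ ℝ^n. -/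
open Finset

/-- **Rearrangement inequality** for sorting: pairing with a monotone vector is maximised, among all
permutations of `x`, by the sorted one. -/
theorem sum_mul_comp_perm_le_sum_mul_comp_sort {n : ℕ} {μ : Fin n → ℝ} (hμ : Monotone μ)
    (x : Fin n → ℝ) (σ : Equiv.Perm (Fin n)) :
    ∑ i, μ i * x (σ i) ≤ ∑ i, μ i * (x ∘ Tuple.sort x) i := by
  have h := (hμ.monovary (Tuple.monotone_sort x)).sum_mul_comp_perm_le_sum_mul
    (σ := σ.trans (Tuple.sort x).symm)
  simpa using h

/-- A sublinear functional is supported at every point `y` by a linear functional lying below it. -/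
theorem exists_linearMap_le_of_sublinear {E : Type*} [AddCommGroup E] [Module ℝ E] {N : E → ℝ}
    (hom : ∀ c : ℝ, 0 ≤ c → ∀ x, N (c • x) = c * N x) (add : ∀ x y, N (x + y) ≤ N x + N y)
    (y : E) : ∃ g : E →ₗ[ℝ] ℝ, g y = N y ∧ ∀ x, g x ≤ N x := by
  have zero : N 0 = 0 := by simpa using hom 0 le_rfl 0
  have H : ∀ c : ℝ, c • y = 0 → c • N y = 0 := by
    intro c hc
    rcases smul_eq_zero.1 hc with rfl | rfl <;> simp [zero]
  obtain ⟨g, hg, hle⟩ := exists_extension_of_le_sublinear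
    (LinearPMap.mkSpanSingleton' y (N y) H) N (fun c hc => hom c hc.le) add (by
      rintro ⟨x, hx⟩
      obtain ⟨c, rfl⟩ := Submodule.mem_span_singleton.1 hx
      rw [LinearPMap.mkSpanSingleton'_apply, smul_eq_mul]
      rcases le_total 0 c with hc | hc
      · exact (hom c hc y).ge
      · have h := add (c • y) ((-c) • y)
        rw [hom (-c) (by linarith), ← add_smul, add_neg_cancel, zero_smul, zero] at h
        simp only [RingHom.id_apply]
        linarith)
  refine ⟨g, ?_, hle⟩
  have h := hg ⟨y, Submodule.mem_span_singleton_self y⟩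
  exact h.trans (LinearPMap.mkSpanSingleton'_apply_self y (N y) H _)

/-- Pairing a probability vector with the sorted rearrangement of `x` is bounded in terms of `x`. -/
theorem bddAbove_image_sum_mul_sort {n : ℕ} {W : Set (Fin n → ℝ)}
    (hW : ∀ μ ∈ W, (∑ i, μ i = 1) ∧ (∀ i, 0 ≤ μ i) ∧ Monotone μ) (x : Fin n → ℝ) :
    BddAbove ((fun μ : Fin n → ℝ => ∑ i, μ i * (x ∘ Tuple.sort x) i) '' W) := by
  refine ⟨∑ j, |x j|, ?_⟩
  rintro _ ⟨μ, hμ, rfl⟩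
  obtain ⟨h1, h0, -⟩ := hW μ hμ
  calc ∑ i, μ i * (x ∘ Tuple.sort x) i ≤ ∑ i, μ i * ∑ j, |x j| := by
        refine sum_le_sum fun i _ => mul_le_mul_of_nonneg_left ?_ (h0 i)
        exact (le_abs_self _).trans
          (single_le_sum (f := fun j => |x j|) (fun j _ => abs_nonneg _) (mem_univ _))
    _ = ∑ j, |x j| := by rw [← sum_mul, h1, one_mul]

/-- A monotone, translation invariant, symmetric sublinear functional attains its value at `x` as the
pairing of the sorted `x` with a non-decreasing probability vector that it dominates. -/
theorem exists_monotone_probability_vector {n : ℕ} {f : (Fin n → ℝ) → ℝ}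
    (hom : ∀ (x : Fin n → ℝ) (a b : ℝ), 0 ≤ a → f (fun i => a * x i + b) = a * f x + b)
    (mono : ∀ x y : Fin n → ℝ, (∀ i, x i ≤ y i) → f x ≤ f y)
    (add : ∀ x y : Fin n → ℝ, f (x + y) ≤ f x + f y)
    (perm : ∀ (x : Fin n → ℝ) (π : Equiv.Perm (Fin n)), f (x ∘ π) = f x) (x : Fin n → ℝ) :
    ∃ ν : Fin n → ℝ, (∑ i, ν i = 1) ∧ (∀ i, 0 ≤ ν i) ∧ Monotone ν ∧
      (∀ z, ∑ i, ν i * z i ≤ f z) ∧ f x = ∑ i, ν i * (x ∘ Tuple.sort x) i := by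
  have smul : ∀ c : ℝ, 0 ≤ c → ∀ z, f (c • z) = c * f z := fun c hc z => by
    simpa [Pi.smul_def] using hom z c 0 hc
  have const : ∀ b : ℝ, f (fun _ => b) = b := fun b => by simpa using hom 0 0 b le_rfl
  obtain ⟨g, hg, hle⟩ := exists_linearMap_le_of_sublinear smul add (x ∘ Tuple.sort x)
  set μ : Fin n → ℝ := fun i => g (Pi.single i 1) with hμ
  have hgμ : ∀ z, g z = ∑ i, μ i * z i := fun z => by
    rw [LinearMap.pi_apply_eq_sum_univ g z]
    refine sum_congr rfl fun i _ => ?_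
    rw [smul_eq_mul, mul_comm, hμ]
    congr 2
    ext j
    simp [Pi.single_apply, eq_comm]
  set σ := Tuple.sort μ
  have hν : ∀ z, ∑ i, (μ ∘ σ) i * z i = g (z ∘ σ.symm) := fun z => by
    rw [hgμ, ← Equiv.sum_comp σ fun i => μ i * (z ∘ σ.symm) i]
    simp
  have dom : ∀ z, ∑ i, (μ ∘ σ) i * z i ≤ f z := fun z => by
    rw [hν, ← perm z σ.symm]
    exact hle _
  refine ⟨μ ∘ σ, ?_, fun i => ?_, Tuple.monotone_sort μ, dom, ?_⟩
  · have h1 := dom fun _ => 1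
    have h2 := dom fun _ => -1
    rw [const] at h1 h2
    simp only [mul_one, mul_neg, sum_neg_distrib] at h1 h2
    linarith
  · have h := dom (Pi.single i (-1))
    have h' : f (Pi.single i (-1)) ≤ f (fun _ => 0) := mono _ _ fun j => by
      rcases eq_or_ne j i with rfl | hj
      · simp
      · simp [hj]
    rw [const] at h'
    simp only [Pi.single_apply, mul_ite, mul_neg, mul_one, mul_zero, sum_ite_eq', mem_univ,
      if_true] at h
    linarith
  · refine le_antisymm ?_ ((dom _).trans_eq (perm x _))
    rw [← perm x (Tuple.sort x), ← hg, hgμ, ← Equiv.sum_comp σ]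
    have h := ((Tuple.monotone_sort μ).monovary
      (Tuple.monotone_sort x)).sum_mul_comp_perm_le_sum_mul (σ := σ)
    exact h

/-- `f : ℝⁿ → ℝ` satisfies (B1), (B2), (B3') full sub-additivity and
(B4) permutation invariance iff it is a supremum of `⟨μ, x^q⟩` over a nonempty
closed convex set `W` contained in `D ∩ C`, the non-decreasing probability vectors. -/
theorem stmt1 (n : ℕ) (hn : 1 ≤ n) (f : (Fin n → ℝ) → ℝ) :
    ((∀ (x : Fin n → ℝ) (a b : ℝ), 0 ≤ a → f (fun i => a * x i + b) = a * f x + b) ∧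
      (∀ x y : Fin n → ℝ, (∀ i, x i ≤ y i) → f x ≤ f y) ∧
      (∀ x y : Fin n → ℝ, f (x + y) ≤ f x + f y) ∧
      (∀ (x : Fin n → ℝ) (π : Equiv.Perm (Fin n)), f (x ∘ π) = f x)) ↔
    (∃ W : Set (Fin n → ℝ), W.Nonempty ∧ IsClosed W ∧ Convex ℝ W ∧
      (∀ μ ∈ W, (∑ i, μ i = 1) ∧ (∀ i, 0 ≤ μ i) ∧ Monotone μ) ∧
      ∀ x : Fin n → ℝ,
        f x = sSup ((fun μ : Fin n → ℝ => ∑ i, μ i * (x ∘ Tuple.sort x) i) '' W)) := by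
  constructor
  · rintro ⟨hom, mono, add, perm⟩
    have key := exists_monotone_probability_vector hom mono add perm
    refine ⟨{μ | (∑ i, μ i = 1) ∧ (∀ i, 0 ≤ μ i) ∧ Monotone μ ∧ ∀ z, ∑ i, μ i * z i ≤ f z},
      ?_, ?_, ?_, fun μ h => ⟨h.1, h.2.1, h.2.2.1⟩, fun x => ?_⟩
    · obtain ⟨ν, h1, h0, hm, hd, -⟩ := key 0
      exact ⟨ν, h1, h0, hm, hd⟩
    · refine (isClosed_eq (by fun_prop) (by fun_prop)).inter (IsClosed.inter ?_ (IsClosed.inter ?_ ?_))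
      · exact isClosed_Ici (a := (0 : Fin n → ℝ))
      · exact isClosed_monotone
      · have h (z : Fin n → ℝ) : IsClosed {μ : Fin n → ℝ | ∑ i, μ i * z i ≤ f z} :=
          isClosed_le (by fun_prop) (by fun_prop)
        have e : {μ : Fin n → ℝ | ∀ z, ∑ i, μ i * z i ≤ f z} =
            ⋂ z, {μ : Fin n → ℝ | ∑ i, μ i * z i ≤ f z} := by
          ext μ
          simp
        have hc := isClosed_iInter h
        rw [← e] at hc
        exact hc
    · rintro μ ⟨h1, h0, hm, hd⟩ ν ⟨k1, k0, km, kd⟩ a b ha hb hab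
      have comb : ∀ z : Fin n → ℝ,
          ∑ i, (a • μ + b • ν) i * z i = a * ∑ i, μ i * z i + b * ∑ i, ν i * z i := fun z => by
        rw [mul_sum, mul_sum, ← sum_add_distrib]
        refine sum_congr rfl fun i _ => ?_
        simp only [Pi.add_apply, Pi.smul_apply, smul_eq_mul]
        ring
      refine ⟨?_, fun i => ?_, fun i j hij => ?_, fun z => ?_⟩
      · have h := comb fun _ => 1
        simp only [mul_one, h1, k1] at h
        rw [h, hab]
      · exact add_nonneg (mul_nonneg ha (h0 i)) (mul_nonneg hb (k0 i))
      · exact add_le_add (mul_le_mul_of_nonneg_left (hm hij) ha)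
          (mul_le_mul_of_nonneg_left (km hij) hb)
      · rw [comb]
        calc a * ∑ i, μ i * z i + b * ∑ i, ν i * z i ≤ a * f z + b * f z :=
              add_le_add (mul_le_mul_of_nonneg_left (hd z) ha)
                (mul_le_mul_of_nonneg_left (kd z) hb)
          _ = f z := by rw [← add_mul, hab, one_mul]
    · obtain ⟨ν, h1, h0, hm, hd, hx⟩ := key x
      symm
      refine IsGreatest.csSup_eq ⟨⟨ν, ⟨h1, h0, hm, hd⟩, hx.symm⟩, ?_⟩
      rintro _ ⟨μ, hμ, rfl⟩
      exact (hμ.2.2.2 _).trans_eq (perm x _)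
  · rintro ⟨W, hne, -, -, hW, hf⟩
    have le_f : ∀ x, ∀ μ ∈ W, ∑ i, μ i * (x ∘ Tuple.sort x) i ≤ f x := fun x μ hμ => by
      rw [hf]
      exact le_csSup (bddAbove_image_sum_mul_sort hW x) (Set.mem_image_of_mem _ hμ)
    have perm_le_f : ∀ x, ∀ μ ∈ W, ∀ σ : Equiv.Perm (Fin n), ∑ i, μ i * x (σ i) ≤ f x :=
      fun x μ hμ σ =>
        (sum_mul_comp_perm_le_sum_mul_comp_sort (hW μ hμ).2.2 x σ).trans (le_f x μ hμ)
    have f_le : ∀ x c, (∀ μ ∈ W, ∑ i, μ i * x (Tuple.sort x i) ≤ c) → f x ≤ c := fun x c h => by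
      rw [hf]
      refine csSup_le (hne.image _) ?_
      rintro _ ⟨μ, hμ, rfl⟩
      exact h μ hμ
    have affine : ∀ μ ∈ W, ∀ (x : Fin n → ℝ) (a b : ℝ),
        ∑ i, μ i * (a * x i + b) = a * ∑ i, μ i * x i + b := fun μ hμ x a b => by
      simp only [mul_add, sum_add_distrib, ← sum_mul, (hW μ hμ).1, one_mul, mul_sum]
      congr 1
      exact sum_congr rfl fun i _ => by ring
    have hom_le : ∀ (x : Fin n → ℝ) (a b : ℝ), 0 ≤ a → f (fun i => a * x i + b) ≤ a * f x + b := by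
      refine fun x a b ha => f_le _ _ fun μ hμ => ?_
      rw [affine μ hμ fun i => x (Tuple.sort (fun i => a * x i + b) i)]
      gcongr
      exact perm_le_f x μ hμ _
    refine ⟨fun x a b ha => (hom_le x a b ha).antisymm ?_, fun x y hxy => ?_, fun x y => ?_,
      fun x π => ?_⟩
    · rcases ha.eq_or_lt with rfl | ha
      · obtain ⟨μ, hμ⟩ := hne
        have h := perm_le_f (fun i => 0 * x i + b) μ hμ 1
        rw [affine μ hμ fun i => x ((1 : Equiv.Perm (Fin n)) i)] at h
        simpa using h
      · have h := hom_le (fun i => a * x i + b) a⁻¹ (-(a⁻¹ * b)) (inv_nonneg.2 ha.le)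
        have e : (fun i => a⁻¹ * (a * x i + b) + -(a⁻¹ * b)) = x := by
          ext i
          field_simp
          ring
        rw [e] at h
        have h' := mul_le_mul_of_nonneg_left h ha.le
        have e' : a * (a⁻¹ * f (fun i => a * x i + b) + -(a⁻¹ * b)) =
            f (fun i => a * x i + b) - b := by
          field_simp
          ring
        linarith
    · refine f_le _ _ fun μ hμ => le_trans ?_ (perm_le_f y μ hμ (Tuple.sort x))
      exact sum_le_sum fun i _ => mul_le_mul_of_nonneg_left (hxy _) ((hW μ hμ).2.1 i)
    · refine f_le _ _ fun μ hμ => ?_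
      simp only [Pi.add_apply, mul_add, sum_add_distrib]
      exact add_le_add (perm_le_f x μ hμ _) (perm_le_f y μ hμ _)
    · rw [hf, hf, Tuple.comp_perm_comp_sort_eq_comp_sort]
end

section
/- Let n ≥ 1 and let f : C → ℝ be defined on the cone C = {x ∈ ℝ^n : x_1 ≤ … ≤ x_n}. Then f satisfies (B1) positive homogeneity and translation invariance, (B2) monotonicity, and (B6) comonotonic additivity (all restricted to arguments in C) if and only if there exists a unique weighting vector μ* ∈ D such that f(x) = ⟨μ*, x⟩ for all x ∈ C. -/
open Finset

/-- The indicator vector of the upper set `{i | k ≤ i}`. -/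
def upperStep (n k : ℕ) : Fin n → ℝ := fun i => if k ≤ (i : ℕ) then 1 else 0

lemma upperStep_monotone (n k : ℕ) : Monotone (upperStep n k) := by
  intro i j hij
  have h : (i : ℕ) ≤ j := hij
  unfold upperStep
  split_ifs
  · exact le_rfl
  · omega
  · exact zero_le_one
  · exact le_rfl

lemma upperStep_antitone (n : ℕ) : Antitone (upperStep n) := by
  intro k l hkl i
  unfold upperStep
  split_ifs
  · exact le_rfl
  · omega
  · exact zero_le_one
  · exact le_rfl

lemma upperStep_of_le {n k : ℕ} (h : n ≤ k) : upperStep n k = 0 := by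
  funext i
  have := i.isLt
  simp only [upperStep, Pi.zero_apply, ite_eq_right_iff]
  omega

lemma upperStep_sub_succ (n k : ℕ) (i : Fin n) :
    upperStep n k i - upperStep n (k + 1) i = if (i : ℕ) = k then 1 else 0 := by
  unfold upperStep
  split_ifs <;> first | omega | norm_num

lemma Monotone.mul_sub_nonneg {ι : Type*} [LinearOrder ι] {x y : ι → ℝ}
    (hx : Monotone x) (hy : Monotone y) (i j : ι) : 0 ≤ (x i - x j) * (y i - y j) := by
  rcases le_total i j with h | h
  · exact mul_nonneg_of_nonpos_of_nonpos (sub_nonpos.2 (hx h)) (sub_nonpos.2 (hy h))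
  · exact mul_nonneg (sub_nonneg.2 (hx h)) (sub_nonneg.2 (hy h))

lemma sum_range_ite_le_sub_succ (F : ℕ → ℝ) (k N : ℕ) :
    ∑ i ∈ range N, (if k ≤ i then F i - F (i + 1) else 0) = F (min k N) - F N := by
  induction N with
  | zero => simp
  | succ N ih =>
    rw [sum_range_succ, ih]
    split_ifs with h
    · rw [min_eq_left h, min_eq_left (by omega)]
      ring
    · rw [min_eq_right (by omega), min_eq_right (by omega)]
      ring

/-- The weights representing a function on the monotone cone are its increments along
the step vectors. -/
lemma weight_eq_sub {n : ℕ} {f : (Fin n → ℝ) → ℝ} {μ : Fin n → ℝ}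
    (h : ∀ x : Fin n → ℝ, Monotone x → f x = ∑ i, μ i * x i) (k : Fin n) :
    μ k = f (upperStep n k) - f (upperStep n (k + 1)) := by
  rw [h _ (upperStep_monotone n k), h _ (upperStep_monotone n (k + 1)), ← sum_sub_distrib]
  simp_rw [← mul_sub, upperStep_sub_succ, Fin.val_inj]
  simp

/-- A translation-invariant, positively homogeneous, additive function on the monotone cone is
the weighted sum given by its increments along the step vectors. -/
lemma eq_sum_of_additive {n : ℕ} {f : (Fin n → ℝ) → ℝ}
    (h1 : ∀ x : Fin n → ℝ, Monotone x → ∀ a b : ℝ, 0 ≤ a →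
        f (fun i => a * x i + b) = a * f x + b)
    (h6 : ∀ x y : Fin n → ℝ, Monotone x → Monotone y → f (x + y) = f x + f y) :
    (∑ i : Fin n, (f (upperStep n i) - f (upperStep n (i + 1))) = 1) ∧
      ∀ x : Fin n → ℝ, Monotone x →
        f x = ∑ i : Fin n, (f (upperStep n i) - f (upperStep n (i + 1))) * x i := by
  have hconst (b : ℝ) : f (fun _ => b) = b := by
    simpa using h1 0 monotone_const 0 b le_rfl
  have hzero : f 0 = 0 := hconst 0
  have hstep (k : ℕ) : ∑ i : Fin n,
      (f (upperStep n i) - f (upperStep n (i + 1))) * upperStep n k i = f (upperStep n k) := by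
    have h := sum_range_ite_le_sub_succ (fun j => f (upperStep n j)) k n
    rw [← Fin.sum_univ_eq_sum_range
      (fun i => if k ≤ i then f (upperStep n i) - f (upperStep n (i + 1)) else 0)] at h
    simp only [upperStep_of_le le_rfl, hzero, sub_zero] at h
    have hk : upperStep n (min k n) = upperStep n k := by
      rcases le_total k n with hkn | hkn
      · rw [min_eq_left hkn]
      · rw [min_eq_right hkn, upperStep_of_le le_rfl, upperStep_of_le hkn]
    rw [hk] at h
    rw [← h]
    refine sum_congr rfl fun i _ => ?_
    simp [upperStep]
  have hsum : ∑ i : Fin n, (f (upperStep n i) - f (upperStep n (i + 1))) = 1 := by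
    have h0 : upperStep n 0 = fun _ => 1 := by
      funext i
      simp [upperStep]
    have h := hstep 0
    rw [h0, hconst] at h
    simpa using h
  refine ⟨hsum, fun x hx => ?_⟩
  rcases Nat.eq_zero_or_pos n with rfl | hn
  · simp at hsum
  let g : ℕ → ℝ := fun k => x ⟨min k (n - 1), by omega⟩
  have hg : Monotone g := by
    intro k l hkl
    exact hx (Fin.mk_le_mk.2 (min_le_min_right _ hkl))
  have htrunc (k : ℕ) : Monotone fun i : Fin n => g (min i k) := by
    intro i j hij
    exact hg (min_le_min_right _ hij)
  have key (k : ℕ) : f (fun i => g (min i k)) =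
      ∑ i : Fin n, (f (upperStep n i) - f (upperStep n (i + 1))) * g (min i k) := by
    induction k with
    | zero => simp only [Nat.min_zero, hconst, ← sum_mul, hsum, one_mul]
    | succ k ih =>
      have hc : 0 ≤ g (k + 1) - g k := sub_nonneg.2 (hg k.le_succ)
      have hsplit (i : Fin n) : g (min i (k + 1)) =
          g (min i k) + (g (k + 1) - g k) * upperStep n (k + 1) i := by
        unfold upperStep
        split_ifs with h
        · rw [min_eq_right h, min_eq_right (by omega)]
          ring
        · rw [min_eq_left (by omega), min_eq_left (by omega)]
          ring
      have hmul := h1 _ (upperStep_monotone n (k + 1)) _ 0 hc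
      simp only [add_zero] at hmul
      have hadd := h6 _ _ (htrunc k) ((upperStep_monotone n (k + 1)).const_mul hc)
      simp only [hsplit, mul_add, sum_add_distrib, ← ih]
      refine hadd.trans ?_
      rw [hmul, ← hstep (k + 1), mul_sum]
      congr 1
      refine sum_congr rfl fun i _ => ?_
      ring
  have hx' (i : Fin n) : g (min i n) = x i := by
    have := i.isLt
    simp only [g]
    congr 1
    ext
    simp only
    omega
  have h := key n
  simp only [hx'] at h
  exact h

/-- A function `f` defined on the cone `C` of non-decreasing vectors
(formalized as a total function whose properties and representation are only
required on `C = {x | Monotone x}`) satisfies (B1), (B2) and (B6) comonotonic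
additivity on `C` iff there is a unique weighting vector `μ*` in the probability
simplex with `f x = ⟨μ*, x⟩` for all `x ∈ C`. -/
theorem stmt2 (n : ℕ) (hn : 1 ≤ n) (f : (Fin n → ℝ) → ℝ) :
    ((∀ x : Fin n → ℝ, Monotone x → ∀ a b : ℝ, 0 ≤ a →
        f (fun i => a * x i + b) = a * f x + b) ∧
      (∀ x y : Fin n → ℝ, Monotone x → Monotone y → (∀ i, x i ≤ y i) → f x ≤ f y) ∧
      (∀ x y : Fin n → ℝ, Monotone x → Monotone y →
        (∀ i j, 0 ≤ (x i - x j) * (y i - y j)) → f (x + y) = f x + f y)) ↔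
    (∃! μ : Fin n → ℝ, ((∑ i, μ i = 1) ∧ ∀ i, 0 ≤ μ i) ∧
      ∀ x : Fin n → ℝ, Monotone x → f x = ∑ i, μ i * x i) := by
  constructor
  · rintro ⟨h1, h2, h6⟩
    obtain ⟨hsum, hrep⟩ := eq_sum_of_additive h1
      fun x y hx hy => h6 x y hx hy (hx.mul_sub_nonneg hy)
    refine ⟨_, ⟨⟨hsum, fun i => sub_nonneg.2 ?_⟩, hrep⟩, ?_⟩
    · exact h2 _ _ (upperStep_monotone n _) (upperStep_monotone n _)
        (upperStep_antitone n (Nat.le_succ _))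
    · rintro ν ⟨-, hν⟩
      exact funext (weight_eq_sub hν)
  · rintro ⟨μ, ⟨⟨hsum, hnonneg⟩, hrep⟩, -⟩
    refine ⟨fun x hx a b ha => ?_, fun x y hx hy hxy => ?_, fun x y hx hy _ => ?_⟩
    · rw [hrep x hx, hrep _ ((hx.const_mul ha).add_const b)]
      simp only [mul_add, sum_add_distrib, ← sum_mul, hsum, one_mul, mul_sum]
      congr 1
      exact sum_congr rfl fun i _ => mul_left_comm _ _ _
    · rw [hrep x hx, hrep y hy]
      exact sum_le_sum fun i _ => mul_le_mul_of_nonneg_left (hxy i) (hnonneg i)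
    · rw [hrep x hx, hrep y hy, hrep (x + y) (hx.add hy)]
      simp only [Pi.add_apply, mul_add, sum_add_distrib]
end

section
/- Let n ≥ 1 and let f : ℝ^n → ℝ. Then f satisfies (B1) positive homogeneity and translation invariance, (B2) monotonicity, (B4) permutation invariance, and (B6) comonotonic additivity if and only if there exists a unique weighting vector μ* ∈ D such that f(x) = ⟨μ*, x^q⟩ for all x ∈ ℝ^n, where x^q is the vector obtained by rearranging the coordinates of x in non-decreasing order. -/
open Finset

/-- The indicator vector of the indices `i ≥ k`. -/
def upperIndicator (n k : ℕ) : Fin n → ℝ := fun i => if k ≤ (i : ℕ) then 1 else 0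

lemma upperIndicator_zero (n : ℕ) : upperIndicator n 0 = fun _ => 1 := by
  funext i
  simp [upperIndicator]

lemma upperIndicator_self (n : ℕ) : upperIndicator n n = 0 := by
  funext i
  simp [upperIndicator]

lemma upperIndicator_monotone (n k : ℕ) : Monotone (upperIndicator n k) := by
  intro i j hij
  have h : (i : ℕ) ≤ j := hij
  unfold upperIndicator
  split_ifs <;> first | omega | norm_num

lemma upperIndicator_succ_le (n k : ℕ) (i : Fin n) :
    upperIndicator n (k + 1) i ≤ upperIndicator n k i := by
  unfold upperIndicator
  split_ifs <;> first | omega | norm_num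

lemma upperIndicator_sub_succ (n : ℕ) (i j : Fin n) :
    upperIndicator n i j - upperIndicator n (i + 1) j = if j = i then 1 else 0 := by
  unfold upperIndicator
  simp only [Fin.ext_iff]
  split_ifs <;> first | omega | norm_num

lemma Monotone.comp_tuple_sort {n : ℕ} {x : Fin n → ℝ} (hx : Monotone x) :
    x ∘ Tuple.sort x = x := by
  rw [Tuple.sort_eq_refl_iff_monotone.2 hx]
  rfl

lemma Equiv.Perm.exists_le_le_apply {n : ℕ} (π : Equiv.Perm (Fin n)) (k : Fin n) :
    ∃ a, a ≤ k ∧ k ≤ π a := by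
  by_contra! h
  have hc : (Finset.Iic k).card ≤ (Finset.Iio k).card :=
    Finset.card_le_card_of_injOn π
      (fun a ha => by simpa using h a (by simpa using ha)) π.injective.injOn
  simp at hc

lemma Tuple.comp_sort_le_comp_sort {n : ℕ} {x y : Fin n → ℝ} (h : ∀ i, x i ≤ y i) (k : Fin n) :
    (x ∘ Tuple.sort x) k ≤ (y ∘ Tuple.sort y) k := by
  obtain ⟨a, hak, hka⟩ :=
    Equiv.Perm.exists_le_le_apply ((Tuple.sort y).trans (Tuple.sort x).symm) k
  calc (x ∘ Tuple.sort x) k ≤ (x ∘ Tuple.sort x) _ := Tuple.monotone_sort x hka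
    _ = x (Tuple.sort y a) := by simp
    _ ≤ y (Tuple.sort y a) := h _
    _ ≤ (y ∘ Tuple.sort y) k := Tuple.monotone_sort y hak

lemma Comonotone.le_of_add_le {ι : Type*} {x y : ι → ℝ}
    (h : ∀ i j, 0 ≤ (x i - x j) * (y i - y j)) {i j : ι} (hij : x i + y i ≤ x j + y j) :
    x i ≤ x j := by
  by_contra! hlt
  nlinarith [h i j]

/-- Summation by parts for a comonotonically additive functional, on truncated monotone vectors. -/
lemma apply_truncation_eq_sum {n : ℕ} {f : (Fin n → ℝ) → ℝ}
    (h1 : ∀ (x : Fin n → ℝ) (a b : ℝ), 0 ≤ a → f (fun i => a * x i + b) = a * f x + b)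
    (h6 : ∀ x y : Fin n → ℝ, (∀ i j, 0 ≤ (x i - x j) * (y i - y j)) → f (x + y) = f x + f y)
    {Y : ℕ → ℝ} (hY : Monotone Y) (m : ℕ) :
    f (fun i => Y (min i m)) =
      ∑ j ∈ Finset.range m, (f (upperIndicator n j) - f (upperIndicator n (j + 1))) * Y j +
        Y m * f (upperIndicator n m) := by
  induction m with
  | zero =>
    have hu : f (upperIndicator n 0) = 1 := by
      simpa [upperIndicator_zero] using h1 0 0 1 le_rfl
    simpa [hu] using h1 0 0 (Y 0) le_rfl
  | succ m ih =>
    have hd : 0 ≤ Y (m + 1) - Y m := sub_nonneg.2 (hY m.le_succ)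
    have hs : (fun i : Fin n => Y (min i (m + 1))) = (fun i : Fin n => Y (min i m)) +
        fun i => (Y (m + 1) - Y m) * upperIndicator n (m + 1) i + 0 := by
      funext i
      simp only [Pi.add_apply, upperIndicator]
      split_ifs with h
      · rw [min_eq_right h, min_eq_right (by omega : m ≤ (i : ℕ))]
        ring
      · rw [min_eq_left (by omega), min_eq_left (by omega)]
        ring
    have hmono : Monotone fun i : Fin n => Y (min i m) :=
      fun i j hij => hY (min_le_min_right m hij)
    have hmono' : Monotone fun i => (Y (m + 1) - Y m) * upperIndicator n (m + 1) i + 0 :=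
      fun i j hij => add_le_add_left
        (mul_le_mul_of_nonneg_left (upperIndicator_monotone n _ hij) hd) 0
    rw [hs, h6, ih, h1 _ _ _ hd, Finset.sum_range_succ]
    · ring
    · intro i j
      rcases le_total i j with hij | hij
      · exact mul_nonneg_of_nonpos_of_nonpos (sub_nonpos.2 (hmono hij))
          (sub_nonpos.2 (hmono' hij))
      · exact mul_nonneg (sub_nonneg.2 (hmono hij)) (sub_nonneg.2 (hmono' hij))

lemma apply_monotone_eq_sum {n : ℕ} (hn : 1 ≤ n) {f : (Fin n → ℝ) → ℝ}
    (h1 : ∀ (x : Fin n → ℝ) (a b : ℝ), 0 ≤ a → f (fun i => a * x i + b) = a * f x + b)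
    (h6 : ∀ x y : Fin n → ℝ, (∀ i j, 0 ≤ (x i - x j) * (y i - y j)) → f (x + y) = f x + f y)
    {y : Fin n → ℝ} (hy : Monotone y) :
    f y = ∑ i : Fin n, (f (upperIndicator n i) - f (upperIndicator n (i + 1))) * y i := by
  have h0 : f 0 = 0 := by simpa [Pi.zero_def] using h1 0 0 0 le_rfl
  have hY : Monotone fun k : ℕ => y ⟨min k (n - 1), by omega⟩ :=
    fun i j hij => hy (Fin.mk_le_mk.2 (min_le_min_right _ hij))
  have key := apply_truncation_eq_sum h1 h6 hY n
  rw [upperIndicator_self, h0, mul_zero, add_zero, Finset.sum_range] at key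
  have hmin : ∀ i : Fin n, min (i : ℕ) (n - 1) = i := fun i => by omega
  have hmin' : ∀ i : Fin n, min (i : ℕ) n = i := fun i => by omega
  simpa only [hmin, hmin', Fin.eta] using key

/-- `f : ℝⁿ → ℝ` satisfies (B1), (B2), (B4) permutation invariance and
(B6) comonotonic additivity iff there is a unique weighting vector `μ*` in the
probability simplex with `f x = ⟨μ*, x^q⟩` for all `x`, where `x^q` is `x` sorted
in non-decreasing order. -/
theorem stmt3 (n : ℕ) (hn : 1 ≤ n) (f : (Fin n → ℝ) → ℝ) :
    ((∀ (x : Fin n → ℝ) (a b : ℝ), 0 ≤ a → f (fun i => a * x i + b) = a * f x + b) ∧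
      (∀ x y : Fin n → ℝ, (∀ i, x i ≤ y i) → f x ≤ f y) ∧
      (∀ (x : Fin n → ℝ) (π : Equiv.Perm (Fin n)), f (x ∘ π) = f x) ∧
      (∀ x y : Fin n → ℝ, (∀ i j, 0 ≤ (x i - x j) * (y i - y j)) →
        f (x + y) = f x + f y)) ↔
    (∃! μ : Fin n → ℝ, ((∑ i, μ i = 1) ∧ ∀ i, 0 ≤ μ i) ∧
      ∀ x : Fin n → ℝ, f x = ∑ i, μ i * (x ∘ Tuple.sort x) i) := by
  constructor
  · rintro ⟨h1, h2, h4, h6⟩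
    have h0 : f 0 = 0 := by simpa [Pi.zero_def] using h1 0 0 0 le_rfl
    have hu : f (upperIndicator n 0) = 1 := by
      simpa [upperIndicator_zero] using h1 0 0 1 le_rfl
    refine ⟨fun i => f (upperIndicator n i) - f (upperIndicator n (i + 1)),
      ⟨⟨?_, fun i => sub_nonneg.2 (h2 _ _ (upperIndicator_succ_le n i))⟩, fun x => ?_⟩, ?_⟩
    · rw [← Finset.sum_range fun i => f (upperIndicator n i) - f (upperIndicator n (i + 1)),
        Finset.sum_range_sub' fun i => f (upperIndicator n i), upperIndicator_self, h0, hu, sub_zero]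
    · rw [← h4 x (Tuple.sort x)]
      exact apply_monotone_eq_sum hn h1 h6 (Tuple.monotone_sort x)
    · rintro ν ⟨-, hν⟩
      funext i
      rw [hν, hν, (upperIndicator_monotone n _).comp_tuple_sort,
        (upperIndicator_monotone n _).comp_tuple_sort, ← Finset.sum_sub_distrib]
      simp [← mul_sub, upperIndicator_sub_succ]
  · rintro ⟨μ, ⟨⟨hsum, hpos⟩, hf⟩, -⟩
    refine ⟨fun x a b ha => ?_, fun x y h => ?_, fun x π => ?_, fun x y h => ?_⟩
    · have hs : (fun i => a * x i + b) ∘ Tuple.sort x =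
          (fun i => a * x i + b) ∘ Tuple.sort fun i => a * x i + b :=
        Tuple.comp_sort_eq_comp_iff_monotone.2 fun i j hij =>
          add_le_add_left (mul_le_mul_of_nonneg_left (Tuple.monotone_sort x hij) ha) b
      rw [hf, hf, ← hs, Finset.mul_sum]
      calc _ = ∑ i, (a * (μ i * (x ∘ Tuple.sort x) i) + μ i * b) :=
            Finset.sum_congr rfl fun i _ => by simp only [Function.comp_apply]; ring
        _ = _ := by rw [Finset.sum_add_distrib, ← Finset.sum_mul, hsum, one_mul]
    · rw [hf, hf]
      exact Finset.sum_le_sum fun i _ =>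
        mul_le_mul_of_nonneg_left (Tuple.comp_sort_le_comp_sort h i) (hpos i)
    · rw [hf, hf, Tuple.comp_perm_comp_sort_eq_comp_sort]
    · have hx : x ∘ Tuple.sort (x + y) = x ∘ Tuple.sort x :=
        Tuple.comp_sort_eq_comp_iff_monotone.2 fun i j hij =>
          Comonotone.le_of_add_le h (Tuple.monotone_sort (x + y) hij)
      have hy : y ∘ Tuple.sort (x + y) = y ∘ Tuple.sort y :=
        Tuple.comp_sort_eq_comp_iff_monotone.2 fun i j hij =>
          Comonotone.le_of_add_le (x := y) (y := x) (fun i j => by simpa only [mul_comm] using h i j)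
            (by simpa [add_comm] using Tuple.monotone_sort (x + y) hij)
      rw [hf, hf, hf, ← hx, ← hy, ← Finset.sum_add_distrib]
      exact Finset.sum_congr rfl fun i _ => mul_add _ _ _
end

section
/- Let n ≥ 1 and let f : ℝ^n → ℝ. Then f satisfies (B1) positive homogeneity and translation invariance, (B2) monotonicity, (B4) permutation invariance, and (B6') full additivity if and only if f(x) = (1/n) Σ_{i=1}^n x_i for all x ∈ ℝ^n; that is, f(x) = ⟨μ*, x⟩ with μ* = (1/n,…,1/n). -/
open Finset

/-- `f : ℝⁿ → ℝ` satisfies (B1), (B2), (B4) permutation invariance and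
(B6') full additivity iff `f` is the uniform average `f x = (1/n) ∑ i, x i`. -/
theorem stmt5 (n : ℕ) (hn : 1 ≤ n) (f : (Fin n → ℝ) → ℝ) :
    ((∀ (x : Fin n → ℝ) (a b : ℝ), 0 ≤ a → f (fun i => a * x i + b) = a * f x + b) ∧
      (∀ x y : Fin n → ℝ, (∀ i, x i ≤ y i) → f x ≤ f y) ∧
      (∀ (x : Fin n → ℝ) (π : Equiv.Perm (Fin n)), f (x ∘ π) = f x) ∧
      (∀ x y : Fin n → ℝ, f (x + y) = f x + f y)) ↔
    (∀ x : Fin n → ℝ, f x = (1 / (n : ℝ)) * ∑ i, x i) := by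
  have : NeZero n := ⟨by omega⟩
  have hn0 : (n : ℝ) ≠ 0 := NeZero.ne _
  constructor
  · rintro ⟨haff, -, hperm, hadd⟩ x
    -- The cyclic shifts of `x` sum to the constant vector with value `∑ i, x i`.
    have hshift : ∑ k : Fin n, x ∘ Equiv.addRight k = fun _ => ∑ i, x i := by
      ext i
      simpa using Equiv.sum_comp (Equiv.addLeft i) x
    have hconst : f (fun _ => ∑ i, x i) = ∑ i, x i := by
      simpa using haff x 0 (∑ i, x i) le_rfl
    have hsum : f (∑ k : Fin n, x ∘ Equiv.addRight k) = n * f x := by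
      rw [show f (∑ k : Fin n, x ∘ Equiv.addRight k) = ∑ k : Fin n, f (x ∘ Equiv.addRight k) from
        map_sum (AddMonoidHom.mk' f hadd) _ _]
      simp only [hperm, sum_const, card_univ, Fintype.card_fin, nsmul_eq_mul]
    rw [hshift, hconst] at hsum
    rw [hsum]
    field_simp
  · intro hf
    simp only [hf]
    refine ⟨fun x a b _ => ?_, fun x y hxy => ?_, fun x π => ?_, fun x y => ?_⟩
    · rw [sum_add_distrib, ← mul_sum]
      simp only [sum_const, card_univ, Fintype.card_fin, nsmul_eq_mul]
      field_simp
    · gcongr with i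
      exact hxy i
    · simp only [Function.comp_apply, Equiv.sum_comp]
    · simp only [Pi.add_apply, sum_add_distrib, mul_add]
end

section
/- Let 𝒳 be a set of real-valued random variables on a measurable space Ω closed under subtracting real constants, let n ≥ 1, and for each i = 1,…,n let V_i, R_i : 𝒳 → ℝ and S_i : 𝒳 → ℝ be such that for every X ∈ 𝒳 and every c ∈ ℝ one has c + V_i(X − c) ≥ R_i(X), with equality if and only if c = S_i(X). Let μ_1,…,μ_n > 0 with Σ_i μ_i = 1. Then for every X ∈ 𝒳, every c ∈ ℝ, and every b ∈ ℝ^n with Σ_i μ_i b_i = 0, one has c + Σ_i μ_i V_i(X − c − b_i) ≥ Σ_i μ_i R_i(X), with equality if and only if c + b_i = S_i(X) for all i; in particular, the minimum over such (c, b) equals Σ_i μ_i R_i(X) and the minimizing value of c is c = Σ_i μ_i S_i(X). -/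
open Finset

/-- Regret–risk–statistic part of the Weighted Risk Quadrangle
mixing theorem (discrete setting). If for each scenario `i` the regret `V i`,
risk `R i` and statistic `S i` satisfy `R i X ≤ c + V i (X - c)` with equality
iff `c = S i X`, then for positive weights `μ` summing to `1`, any `X ∈ 𝒳`,
`c ∈ ℝ` and `b` with `∑ μ i * b i = 0`:
`∑ μ i * R i X ≤ c + ∑ μ i * V i (X - c - b i)`, with equality iff
`c + b i = S i X` for all `i`; in that case `c = ∑ μ i * S i X`, and the
minimum is attained. -/
theorem stmt12 {Ω : Type*} [MeasurableSpace Ω] (𝒳 : Set (Ω → ℝ))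
    (hclosed : ∀ X ∈ 𝒳, ∀ c : ℝ, (fun ω => X ω - c) ∈ 𝒳)
    (n : ℕ) (hn : 1 ≤ n)
    (V R S : Fin n → (Ω → ℝ) → ℝ)
    (hquad : ∀ i : Fin n, ∀ X ∈ 𝒳, ∀ c : ℝ,
      R i X ≤ c + V i (fun ω => X ω - c) ∧
      (c + V i (fun ω => X ω - c) = R i X ↔ c = S i X))
    (μ : Fin n → ℝ) (hμpos : ∀ i, 0 < μ i) (hμsum : ∑ i, μ i = 1) :
    ∀ X ∈ 𝒳, (∀ c : ℝ, ∀ b : Fin n → ℝ, ∑ i, μ i * b i = 0 →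
      ((∑ i, μ i * R i X) ≤ c + ∑ i, μ i * V i (fun ω => X ω - c - b i)) ∧
      ((c + ∑ i, μ i * V i (fun ω => X ω - c - b i) = ∑ i, μ i * R i X) ↔
        ∀ i, c + b i = S i X) ∧
      ((∀ i, c + b i = S i X) → c = ∑ i, μ i * S i X)) ∧
      (∃ (c : ℝ) (b : Fin n → ℝ), (∑ i, μ i * b i = 0) ∧
        c + ∑ i, μ i * V i (fun ω => X ω - c - b i) = ∑ i, μ i * R i X ∧
        c = ∑ i, μ i * S i X) := by
  intro X hX
  have key : ∀ c : ℝ, ∀ b : Fin n → ℝ, ∑ i, μ i * b i = 0 →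
      c + ∑ i, μ i * V i (fun ω => X ω - c - b i)
        = ∑ i, μ i * ((c + b i) + V i (fun ω => X ω - (c + b i))) := by
    intro c b hb
    simp only [mul_add, sum_add_distrib, ← sum_mul, hμsum, hb, sub_sub, one_mul, add_zero]
  have hle : ∀ c : ℝ, ∀ b : Fin n → ℝ, ∀ i ∈ univ,
      μ i * R i X ≤ μ i * ((c + b i) + V i (fun ω => X ω - (c + b i))) := fun c b i _ =>
    mul_le_mul_of_nonneg_left (hquad i X hX (c + b i)).1 (hμpos i).le
  have heq : ∀ c : ℝ, ∀ b : Fin n → ℝ, ∑ i, μ i * b i = 0 →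
      ((c + ∑ i, μ i * V i (fun ω => X ω - c - b i) = ∑ i, μ i * R i X) ↔
        ∀ i, c + b i = S i X) := by
    intro c b hb
    rw [key c b hb, eq_comm, sum_eq_sum_iff_of_le (hle c b)]
    refine ⟨fun h i => ?_, fun h i _ => ?_⟩
    · exact (hquad i X hX (c + b i)).2.1
        (mul_left_cancel₀ (hμpos i).ne' (h i (mem_univ i))).symm
    · rw [(hquad i X hX (c + b i)).2.2 (h i)]
  refine ⟨fun c b hb => ⟨?_, heq c b hb, fun h => ?_⟩, ?_⟩
  · rw [key c b hb]
    exact sum_le_sum (hle c b)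
  · simp only [← h, mul_add, sum_add_distrib, ← sum_mul, hμsum, hb, one_mul, add_zero]
  · have hb : ∑ i, μ i * (S i X - ∑ j, μ j * S j X) = 0 := by
      simp only [mul_sub, sum_sub_distrib, ← sum_mul, hμsum, one_mul, sub_self]
    exact ⟨_, _, hb, (heq _ _ hb).2 fun i => add_sub_cancel _ _, rfl⟩
end

section
/- Let 𝒳 be a set of real-valued random variables on a measurable space Ω closed under subtracting real constants, let n ≥ 1, and for each i = 1,…,n let E_i, D_i : 𝒳 → ℝ and S_i : 𝒳 → ℝ be such that for every X ∈ 𝒳 and every c ∈ ℝ one has E_i(X − c) ≥ D_i(X), with equality if and only if c = S_i(X). Let μ_1,…,μ_n > 0 with Σ_i μ_i = 1. Then for every X ∈ 𝒳, every c ∈ ℝ, and every b ∈ ℝ^n with Σ_i μ_i b_i = 0, one has Σ_i μ_i E_i(X − c − b_i) ≥ Σ_i μ_i D_i(X), with equality if and only if c + b_i = S_i(X) for all i; in particular, the minimum over such (c, b) equals Σ_i μ_i D_i(X) and the minimizing value of c is c = Σ_i μ_i S_i(X). -/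
open Finset

/-- Error–deviation–statistic part of the Weighted Risk Quadrangle
mixing theorem (discrete setting). If for each scenario `i` the error `E i`,
deviation `D i` and statistic `S i` satisfy `D i X ≤ E i (X - c)` with equality
iff `c = S i X`, then for positive weights `μ` summing to `1`, any `X ∈ 𝒳`,
`c ∈ ℝ` and `b` with `∑ μ i * b i = 0`:
`∑ μ i * D i X ≤ ∑ μ i * E i (X - c - b i)`, with equality iff
`c + b i = S i X` for all `i`; in that case `c = ∑ μ i * S i X`, and the
minimum is attained. -/
theorem stmt13 {Ω : Type*} [MeasurableSpace Ω] (𝒳 : Set (Ω → ℝ))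
    (hclosed : ∀ X ∈ 𝒳, ∀ c : ℝ, (fun ω => X ω - c) ∈ 𝒳)
    (n : ℕ) (hn : 1 ≤ n)
    (E D S : Fin n → (Ω → ℝ) → ℝ)
    (hquad : ∀ i : Fin n, ∀ X ∈ 𝒳, ∀ c : ℝ,
      D i X ≤ E i (fun ω => X ω - c) ∧
      (E i (fun ω => X ω - c) = D i X ↔ c = S i X))
    (μ : Fin n → ℝ) (hμpos : ∀ i, 0 < μ i) (hμsum : ∑ i, μ i = 1) :
    ∀ X ∈ 𝒳, (∀ c : ℝ, ∀ b : Fin n → ℝ, ∑ i, μ i * b i = 0 →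
      ((∑ i, μ i * D i X) ≤ ∑ i, μ i * E i (fun ω => X ω - c - b i)) ∧
      ((∑ i, μ i * E i (fun ω => X ω - c - b i) = ∑ i, μ i * D i X) ↔
        ∀ i, c + b i = S i X) ∧
      ((∀ i, c + b i = S i X) → c = ∑ i, μ i * S i X)) ∧
      (∃ (c : ℝ) (b : Fin n → ℝ), (∑ i, μ i * b i = 0) ∧
        (∑ i, μ i * E i (fun ω => X ω - c - b i) = ∑ i, μ i * D i X) ∧
        c = ∑ i, μ i * S i X) := by
  intro X hX
  have shift : ∀ (c : ℝ) (b : Fin n → ℝ) (i : Fin n),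
      E i (fun ω => X ω - c - b i) = E i (fun ω => X ω - (c + b i)) := by
    intro c b i
    simp only [sub_sub]
  have termwise_le : ∀ (c : ℝ) (b : Fin n → ℝ), ∀ i ∈ Finset.univ,
      μ i * D i X ≤ μ i * E i (fun ω => X ω - c - b i) := by
    intro c b i _
    rw [shift]
    exact mul_le_mul_of_nonneg_left (hquad i X hX _).1 (hμpos i).le
  have sum_eq_iff : ∀ (c : ℝ) (b : Fin n → ℝ),
      (∑ i, μ i * E i (fun ω => X ω - c - b i) = ∑ i, μ i * D i X) ↔
        ∀ i, c + b i = S i X := by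
    intro c b
    rw [eq_comm, Finset.sum_eq_sum_iff_of_le (termwise_le c b)]
    simp only [Finset.mem_univ, true_implies]
    refine forall_congr' fun i => ?_
    rw [mul_right_inj' (hμpos i).ne', shift, eq_comm]
    exact (hquad i X hX _).2
  refine ⟨fun c b hb => ⟨Finset.sum_le_sum (termwise_le c b), sum_eq_iff c b, fun h => ?_⟩, ?_⟩
  · simp only [← h, mul_add, Finset.sum_add_distrib, ← Finset.sum_mul, hμsum, hb, one_mul,
      add_zero]
  · refine ⟨∑ i, μ i * S i X, fun i => S i X - ∑ j, μ j * S j X, ?_,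
      (sum_eq_iff _ _).2 fun i => add_sub_cancel _ _, rfl⟩
    simp only [mul_sub, Finset.sum_sub_distrib, ← Finset.sum_mul, hμsum, one_mul, sub_self]
end

section
/- Let C̃ be the set of bounded, non-decreasing, left-continuous functions φ : [0,1] → ℝ (viewed inside L^∞([0,1])), and let f : C̃ → ℝ be monotone in the sense that ψ ≤ φ pointwise implies f(ψ) ≤ f(φ). Let φ_X ∈ C̃ satisfy φ_X(t) − φ_X(s) ≥ δ(t − s) for all 0 ≤ s < t ≤ 1, for some δ > 0. Let ν ∈ L¹([0,1]) be a subgradient of f at φ_X relative to C̃, i.e. for every ψ ∈ C̃ one has f(ψ) ≥ f(φ_X) + ∫₀¹ (ψ(t) − φ_X(t)) ν(t) dt. Then ν(t) ≥ 0 for almost every t ∈ [0,1]. -/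
open MeasureTheory

/-- Lebesgue measure restricted to the unit interval `[0,1]`. -/
noncomputable def μ01 : Measure ℝ := volume.restrict (Set.Icc 0 1)

/-- Membership in `C̃`: bounded, non-decreasing, left-continuous on `[0,1]`. -/
def memCtilde (g : ℝ → ℝ) : Prop :=
  MonotoneOn g (Set.Icc 0 1) ∧
    (∀ x ∈ Set.Ioc (0:ℝ) 1, Filter.Tendsto g (nhdsWithin x (Set.Iio x)) (nhds (g x))) ∧
    ∃ K : ℝ, ∀ x ∈ Set.Icc (0:ℝ) 1, |g x| ≤ K

open Filter Topology
open scoped NNReal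

/-- An integrable function whose integrals over closed sets are nonnegative is nonnegative
almost everywhere. -/
theorem ae_nonneg_of_forall_isClosed_setIntegral_nonneg {α : Type*} [TopologicalSpace α]
    [MeasurableSpace α] [OpensMeasurableSpace α] {μ : Measure α} [IsFiniteMeasure μ]
    [μ.WeaklyRegular] {ν : α → ℝ} (hν : Integrable ν μ)
    (h : ∀ F : Set α, IsClosed F → 0 ≤ ∫ x in F, ν x ∂μ) : 0 ≤ᵐ[μ] ν := by
  by_contra hneg
  have hpos : 0 < μ {x | ν x < 0} := by
    rw [pos_iff_ne_zero]
    intro h0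
    apply hneg
    rw [EventuallyLE, ae_iff]
    simpa using h0
  have hnull : NullMeasurableSet {x | ν x < 0} μ :=
    hν.aestronglyMeasurable.aemeasurable.nullMeasurable measurableSet_Iio
  obtain ⟨t, ht, ht_meas, ht_ae⟩ := hnull.exists_measurable_subset_ae_eq
  rw [← measure_congr ht_ae] at hpos
  obtain ⟨F, hFt, hF, hFpos⟩ := ht_meas.exists_lt_isClosed_of_ne_top (measure_ne_top μ t) hpos
  have hlt : ∀ x ∈ F, ν x < 0 := fun x hx => ht (hFt hx)
  have hnonneg : 0 ≤ᵐ[μ.restrict F] fun x => -ν x :=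
    ae_restrict_of_forall_mem hF.measurableSet fun x hx => by simpa using (hlt x hx).le
  have hint := (setIntegral_pos_iff_support_of_nonneg_ae hnonneg hν.neg.integrableOn).2
    (hFpos.trans_le (measure_mono fun x hx => ⟨by simpa using (hlt x hx).ne, hx⟩))
  rw [integral_neg] at hint
  linarith [h F hF]

/-- An integrable function whose integrals against Lipschitz functions with values in `[0, 1]`
are nonnegative is nonnegative almost everywhere. -/
theorem ae_nonneg_of_forall_lipschitzWith_integral_mul_nonneg {α : Type*} [PseudoEMetricSpace α]
    [MeasurableSpace α] [BorelSpace α] {μ : Measure α} [IsFiniteMeasure μ]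
    {ν : α → ℝ} (hν : Integrable ν μ)
    (h : ∀ (K : ℝ≥0) (g : α → ℝ≥0), LipschitzWith K g → (∀ x, g x ≤ 1) →
      0 ≤ ∫ x, (g x : ℝ) * ν x ∂μ) : 0 ≤ᵐ[μ] ν := by
  refine ae_nonneg_of_forall_isClosed_setIntegral_nonneg hν fun F hF => ?_
  have hδ (n : ℕ) : (0 : ℝ) < 1 / ((n : ℝ) + 1) := Nat.one_div_pos_of_nat
  have hlim := thickenedIndicator_tendsto_indicator_closure hδ
    tendsto_one_div_add_atTop_nhds_zero_nat F
  rw [hF.closure_eq, tendsto_pi_nhds] at hlim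
  have key : Tendsto (fun n => ∫ x, (thickenedIndicator (hδ n) F x : ℝ) * ν x ∂μ) atTop
      (𝓝 (∫ x, F.indicator ν x ∂μ)) := by
    refine tendsto_integral_of_dominated_convergence (fun x => |ν x|) (fun n => ?_) hν.abs
      (fun n => .of_forall fun x => ?_) (.of_forall fun x => ?_)
    · exact (NNReal.continuous_coe.comp
        (thickenedIndicator (hδ n) F).continuous).aestronglyMeasurable.mul hν.aestronglyMeasurable
    · rw [norm_mul, Real.norm_eq_abs, Real.norm_eq_abs, NNReal.abs_eq]
      exact mul_le_of_le_one_left (abs_nonneg _)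
        (by exact_mod_cast thickenedIndicator_le_one (hδ n) F x)
    · have hx := ((NNReal.continuous_coe.tendsto _).comp (hlim x)).mul_const (ν x)
      by_cases hxF : x ∈ F <;> simpa [hxF, Function.comp_def] using hx
  rw [← integral_indicator hF.measurableSet]
  exact ge_of_tendsto' key fun n =>
    h _ _ (lipschitzWith_thickenedIndicator (hδ n) F) (thickenedIndicator_le_one (hδ n) F)

/-- Subtracting a multiple of a Lipschitz function, small relative to the slope of `φ`, from `φ`
does not leave the cone `C̃`. -/
theorem memCtilde.sub_mul_lipschitzWith {φ : ℝ → ℝ} (hφ : memCtilde φ) {δ ε : ℝ} (hε : 0 ≤ ε)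
    (hslope : ∀ s t : ℝ, 0 ≤ s → s < t → t ≤ 1 → δ * (t - s) ≤ φ t - φ s)
    {K : ℝ≥0} {g : ℝ → ℝ≥0} (hg : LipschitzWith K g) (hg1 : ∀ x, g x ≤ 1) (hεK : ε * K ≤ δ) :
    memCtilde fun t => φ t - ε * g t := by
  obtain ⟨-, hleft, C, hC⟩ := hφ
  refine ⟨fun s hs t ht hst => ?_, fun x hx => ?_, C + ε, fun x hx => ?_⟩
  · rcases hst.eq_or_lt with rfl | hlt
    · exact le_rfl
    have hdist : (g t : ℝ) - g s ≤ K * (t - s) := by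
      have := hg.dist_le_mul t s
      rw [NNReal.dist_eq, Real.dist_eq, abs_of_pos (sub_pos.2 hlt)] at this
      exact (le_abs_self _).trans this
    have h1 := mul_le_mul_of_nonneg_left hdist hε
    have h2 := mul_le_mul_of_nonneg_right hεK (sub_pos.2 hlt).le
    have h3 := hslope s t hs.1 hlt ht.2
    dsimp only
    linarith
  · have hcont : Continuous fun t => ε * (g t : ℝ) := by
      have := hg.continuous
      fun_prop
    exact (hleft x hx).sub (hcont.continuousAt.tendsto.mono_left nhdsWithin_le_nhds)
  · have hgx : (g x : ℝ) ≤ 1 := by exact_mod_cast hg1 x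
    calc |φ x - ε * g x| ≤ |φ x| + |ε * g x| := abs_sub _ _
      _ ≤ C + ε := by
        rw [abs_of_nonneg (by positivity : 0 ≤ ε * (g x : ℝ))]
        exact add_le_add (hC x hx) (mul_le_of_le_one_right hε hgx)

/-- Let `f` be monotone on the cone `C̃` of bounded non-decreasing
left-continuous functions on `[0,1]`, let `φ_X ∈ C̃` have slope bounded below by
`δ > 0`, and let `ν ∈ L¹([0,1])` be a subgradient of `f` at `φ_X` relative to
`C̃`. Then `ν ≥ 0` almost everywhere on `[0,1]`. -/
theorem stmt15 (f : (ℝ → ℝ) → ℝ)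
    (hmono : ∀ g h : ℝ → ℝ, memCtilde g → memCtilde h →
      (∀ t ∈ Set.Icc (0:ℝ) 1, g t ≤ h t) → f g ≤ f h)
    (φX : ℝ → ℝ) (hφX : memCtilde φX)
    (δ : ℝ) (hδ : 0 < δ)
    (hslope : ∀ s t : ℝ, 0 ≤ s → s < t → t ≤ 1 → δ * (t - s) ≤ φX t - φX s)
    (ν : ℝ → ℝ) (hν : Integrable ν μ01)
    (hsub : ∀ ψ : ℝ → ℝ, memCtilde ψ →
      f φX + ∫ t, (ψ t - φX t) * ν t ∂μ01 ≤ f ψ) :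
    (0 : ℝ → ℝ) ≤ᵐ[μ01] ν := by
  have : IsFiniteMeasure μ01 := by
    unfold μ01
    infer_instance
  refine ae_nonneg_of_forall_lipschitzWith_integral_mul_nonneg hν fun K g hg hg1 => ?_
  have hK : (0 : ℝ) < K + 1 := by positivity
  have hε : 0 < δ / (K + 1) := by positivity
  have hεK : δ / (K + 1) * K ≤ δ := by
    rw [div_mul_eq_mul_div, div_le_iff₀ hK]
    linarith
  have hψ := hφX.sub_mul_lipschitzWith hε.le hslope hg hg1 hεK
  have hle := (hsub _ hψ).trans
    (hmono _ _ hψ hφX fun t _ => sub_le_self _ (mul_nonneg hε.le (g t).coe_nonneg))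
  have hint : ∫ t, (φX t - δ / (K + 1) * g t - φX t) * ν t ∂μ01
      = -(δ / (K + 1)) * ∫ t, (g t : ℝ) * ν t ∂μ01 := by
    rw [← integral_const_mul]
    congr 1 with t
    ring
  rw [hint] at hle
  exact nonneg_of_mul_nonneg_right (by linarith) hε
end
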